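/- arXiv:2204.13202 — 3 statements merged into one kernel-verified Lean document; each statement's English description precedes it below -/
import Mathlib

section
/- Let k ⊆ k' ⊆ K be fields and A a finite-dimensional K-algebra. Then ed_{k'}(A) ≤ ed_k(A). Moreover, if k' is algebraic over k, then ed_{k'}(A) = ed_k(A). -/
open scoped TensorProduct

universe u

/-- The transcendence degree of `E` over `k`, as a cardinal: the supremum of the cardinalities
of algebraically independent subsets of `E`. -/
noncomputable def trdeg (k E : Type u) [CommRing k] [CommRing E] [Algebra k E] : Cardinal :=
  ⨆ s : {s : Set E // AlgebraicIndependent k ((↑) : s → E)}, Cardinal.mk s.1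

/-- The `K`-algebra `A` descends to the intermediate field `K₀` of `K/k`: there is a
`K₀`-algebra `A₀` with `A ≅ A₀ ⊗_{K₀} K` as `K`-algebras. -/
def Descends (k : Type u) {K : Type u} (A : Type u) [Field k] [Field K] [Algebra k K]
    [Ring A] [Algebra K A] (K₀ : IntermediateField k K) : Prop :=
  ∃ (A₀ : Type u) (_ : Ring A₀) (_ : Algebra K₀ A₀),
    Nonempty ((K ⊗[K₀] A₀) ≃ₐ[K] A)

/-- The essential dimension `ed k K A` of a `K`-algebra `A` over the base field `k ⊆ K`:
the minimum of `trdeg k K₀` over all intermediate fields `k ⊆ K₀ ⊆ K` to which `A`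
descends. -/
noncomputable def ed (k K A : Type u) [Field k] [Field K] [Algebra k K]
    [Ring A] [Algebra K A] : Cardinal :=
  ⨅ K₀ : {K₀ : IntermediateField k K // Descends k A K₀}, trdeg k K₀.1

open IntermediateField

/-- Every algebra over `K` descends to `K` itself. -/
theorem descends_top (k K A : Type u) [Field k] [Field K] [Algebra k K]
    [Ring A] [Algebra K A] : Descends k A (⊤ : IntermediateField k K) := by
  have hcomm (x : K) (y : A) :
      Commute (Algebra.ofId K A x) (AlgHom.id (⊤ : IntermediateField k K) A y) :=
    Algebra.commutes x y
  let φ : K ⊗[(⊤ : IntermediateField k K)] A →ₐ[K] A :=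
    Algebra.TensorProduct.lift (Algebra.ofId K A) (AlgHom.id _ A) hcomm
  have hφ (a : A) : φ (1 ⊗ₜ a) = a := by simp [φ]
  have hsurj := Algebra.TensorProduct.includeRight_surjective (S := K) A
    (R := (⊤ : IntermediateField k K)) fun x => ⟨⟨x, mem_top⟩, rfl⟩
  refine ⟨A, inferInstance, inferInstance,
    ⟨AlgEquiv.ofBijective φ ⟨fun x y hxy => ?_, fun a => ⟨1 ⊗ₜ a, hφ a⟩⟩⟩⟩
  obtain ⟨a, rfl⟩ := hsurj x
  obtain ⟨b, rfl⟩ := hsurj y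
  exact congrArg _ ((hφ a).symm.trans (hxy.trans (hφ b)))

/-- The canonical isomorphism `T ⊗[R] B ≃ T ⊗[S] (S ⊗[R] B)` for a possibly noncommutative
`R`-algebra `B`. -/
noncomputable def cancelBaseChangeAlgEquiv (R S T B : Type*) [CommRing R] [CommRing S]
    [CommRing T] [Ring B] [Algebra R S] [Algebra S T] [Algebra R T] [IsScalarTower R S T]
    [Algebra R B] : T ⊗[R] B ≃ₐ[T] T ⊗[S] (S ⊗[R] B) :=
  Algebra.TensorProduct.algEquivOfLinearEquivTensorProduct
    (TensorProduct.AlgebraTensorModule.cancelBaseChange R S T T B).symm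
    (fun _ _ _ _ => by simp)
    (by simp [Algebra.TensorProduct.one_def])

/-- Descent to a subfield implies descent to any larger subfield, even when the two are
regarded as extensions of different base fields. -/
theorem Descends.of_le {k k' K A : Type u} [Field k] [Field k'] [Field K]
    [Algebra k K] [Algebra k' K] [Ring A] [Algebra K A]
    {K₀ : IntermediateField k K} {K₁ : IntermediateField k' K}
    (hle : K₀.toSubfield ≤ K₁.toSubfield) (h : Descends k A K₀) : Descends k' A K₁ := by
  obtain ⟨A₀, _, _, ⟨e⟩⟩ := h
  let : Algebra K₀ K₁ := (Subfield.inclusion hle).toAlgebra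
  have : IsScalarTower K₀ K₁ K := IsScalarTower.of_algebraMap_eq fun _ => rfl
  exact ⟨K₁ ⊗[K₀] A₀, inferInstance, inferInstance,
    ⟨(cancelBaseChangeAlgEquiv K₀ K₁ K A₀).symm.trans e⟩⟩

/-- The transcendence degree does not increase when passing to a compositum with a larger
base field. -/
theorem trdeg_adjoin_le (k k' K : Type u) [Field k] [Field k'] [Field K]
    [Algebra k k'] [Algebra k' K] [Algebra k K] [IsScalarTower k k' K]
    (K₀ : IntermediateField k K) :
    Algebra.trdeg k' (adjoin k' (K₀ : Set K)) ≤ Algebra.trdeg k K₀ := by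
  obtain ⟨s, hs⟩ := exists_isTranscendenceBasis k K₀
  rw [← hs.cardinalMk_eq_trdeg]
  let f : K₀ →+* adjoin k' (K₀ : Set K) :=
    (Subfield.inclusion (show K₀.toSubfield ≤ (adjoin k' (K₀ : Set K)).toSubfield from
      subset_adjoin k' _))
  refine le_trans ?_ (Cardinal.mk_image_le (f := f) (s := s))
  let S := Algebra.adjoin k' (f '' s)
  have mem_S (x : K₀) (hx : x ∈ Algebra.adjoin k s) : f x ∈ S := by
    induction hx using Algebra.adjoin_induction with
    | mem x hx => exact Algebra.subset_adjoin ⟨x, hx, rfl⟩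
    | algebraMap r =>
      have : f (algebraMap k K₀ r) = algebraMap k' _ (algebraMap k k' r) :=
        Subtype.ext (IsScalarTower.algebraMap_apply k k' K r)
      exact this ▸ S.algebraMap_mem _
    | add x y _ _ hx hy => exact map_add f x y ▸ add_mem hx hy
    | mul x y _ _ hx hy => exact map_mul f x y ▸ mul_mem hx hy
  have halg : Algebra.IsAlgebraic (Algebra.adjoin k s) K₀ := by
    have h := hs.isAlgebraic
    rwa [Subtype.range_coe] at h
  let g : Algebra.adjoin k s →+* S :=
    (f.comp (algebraMap (Algebra.adjoin k s) K₀)).codRestrict S fun x => mem_S x x.2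
  have hg : Function.Injective g := fun x y h =>
    Subtype.ext (f.injective (congrArg Subtype.val h))
  have key (x : K) (hx : x ∈ adjoin k' (K₀ : Set K)) :
      IsAlgebraic S (⟨x, hx⟩ : adjoin k' (K₀ : Set K)) := by
    induction hx using adjoin_induction with
    | mem x hx => exact (halg.isAlgebraic ⟨x, hx⟩).ringHom_of_comp_eq g f hg rfl
    | algebraMap r => exact isAlgebraic_algebraMap (algebraMap k' S r)
    | add x y _ _ hx hy => exact hx.add hy
    | inv x _ hx => exact hx.inv
    | mul x y _ _ hx hy => exact hx.mul hy
  have : Algebra.IsAlgebraic S (adjoin k' (K₀ : Set K)) := ⟨fun x => key x x.2⟩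
  exact Algebra.IsAlgebraic.trdeg_le_cardinalMk _ _

/-- For fields `k ⊆ k' ⊆ K` and a finite-dimensional `K`-algebra `A`,
`ed_{k'}(A) ≤ ed_k(A)`, with equality when `k'` is algebraic over `k`. -/
theorem statement_2 (k k' K A : Type u) [Field k] [Field k'] [Field K]
    [Algebra k k'] [Algebra k' K] [Algebra k K] [IsScalarTower k k' K]
    [Ring A] [Algebra K A] [FiniteDimensional K A] :
    ed k' K A ≤ ed k K A ∧ (Algebra.IsAlgebraic k k' → ed k' K A = ed k K A) := by
  have hle : ed k' K A ≤ ed k K A := by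
    have : Nonempty {K₀ : IntermediateField k K // Descends k A K₀} :=
      ⟨⟨⊤, descends_top k K A⟩⟩
    refine le_ciInf fun ⟨K₀, h⟩ => ?_
    have h₁ : Descends k' A (adjoin k' (K₀ : Set K)) := h.of_le (subset_adjoin k' _)
    exact (ciInf_le' _ (⟨_, h₁⟩ : {K₁ : IntermediateField k' K // Descends k' A K₁})).trans
      (trdeg_adjoin_le k k' K K₀)
  refine ⟨hle, fun _ => hle.antisymm ?_⟩
  have : Nonempty {K₀ : IntermediateField k' K // Descends k' A K₀} :=
    ⟨⟨⊤, descends_top k' K A⟩⟩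
  refine le_ciInf fun ⟨K₀, h⟩ => ?_
  have h₁ : Descends k A (K₀.restrictScalars k) := h.of_le le_rfl
  refine (ciInf_le' _ (⟨_, h₁⟩ : {K₁ : IntermediateField k K // Descends k A K₁})).trans_eq ?_
  have hadd : Algebra.trdeg k k' + Algebra.trdeg k' K₀ = Algebra.trdeg k K₀ :=
    trdeg_add_eq k k'
  rw [trdeg_eq_zero, zero_add] at hadd
  exact hadd.symm
end

section
/- Let k ⊆ K ⊆ L be fields such that L/K is a simple finite extension. Let K'/K be another field extension (not necessarily finite), and let L' = K'L be a compositum of K' and L over K (a field generated by K' and an embedded copy of L over K). Then ed_k(L'/K') ≤ ed_k(L/K). -/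
open scoped TensorProduct

universe u

/-- If `L/K` is a finite simple extension generated over `K` by an `F`-subalgebra `S` which is
finite-dimensional over the subfield `F` of `K`, then a generator of `L/K` can be found in `S`. -/
theorem exists_mem_subalgebra_adjoin_eq_top {F K L : Type*} [Field F] [Field K] [Field L]
    [Algebra F K] [Algebra K L] [Algebra F L] [IsScalarTower F K L] [FiniteDimensional K L]
    (hsimple : ∃ α : L, IntermediateField.adjoin K {α} = ⊤)
    (S : Subalgebra F L) [FiniteDimensional F S]
    (hS : IntermediateField.adjoin K (S : Set L) = ⊤) :
    ∃ β ∈ S, IntermediateField.adjoin K {β} = ⊤ := by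
  suffices h : ∃ β ∈ S, (S : Set L) ⊆ IntermediateField.adjoin K {β} by
    obtain ⟨β, hβ, h⟩ := h
    exact ⟨β, hβ, top_le_iff.mp (hS ▸ IntermediateField.adjoin_le_iff.mpr h)⟩
  rcases finite_or_infinite F with hF | hF
  · have : Finite S := Module.finite_of_finite F
    obtain ⟨g, hg⟩ := IsCyclic.exists_generator (α := Sˣ)
    let _ : Field S := (Finite.isField_of_domain S).toField
    refine ⟨(g : S), (g : S).2, fun x hx ↦ ?_⟩
    by_cases hx0 : (⟨x, hx⟩ : S) = 0
    · rw [show x = 0 from congrArg Subtype.val hx0]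
      exact zero_mem _
    · obtain ⟨u, hu⟩ : IsUnit (⟨x, hx⟩ : S) := isUnit_iff_ne_zero.mpr hx0
      obtain ⟨n, hn⟩ := mem_powers_iff_mem_zpowers.mpr (hg u)
      have hxn : x = ((g : S) : L) ^ n := by
        have := congrArg (fun v : Sˣ ↦ ((v : S) : L)) hn
        simpa [hu] using this.symm
      rw [hxn]
      exact pow_mem (IntermediateField.mem_adjoin_simple_self K _) n
  · have : Finite (IntermediateField K L) :=
      (Field.exists_primitive_element_iff_finite_intermediateField K L).mp
        ⟨inferInstance, hsimple⟩
    let p : IntermediateField K L → Subspace F S := fun E ↦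
      ((E.toSubalgebra.toSubmodule.restrictScalars F).comap S.val.toLinearMap)
    by_contra! hcon
    let q : {E : IntermediateField K L // ¬ (S : Set L) ⊆ E} → Subspace F S := fun E ↦ p E
    obtain ⟨E, hE⟩ := Subspace.exists_eq_top_of_iUnion_eq_univ (p := q) <| by
      refine Set.eq_univ_of_forall fun β ↦ Set.mem_iUnion.mpr
        ⟨⟨IntermediateField.adjoin K {(β : L)}, hcon β β.2⟩, ?_⟩
      exact IntermediateField.mem_adjoin_simple_self K (β : L)
    refine E.2 fun x hx ↦ ?_
    have : (⟨x, hx⟩ : S) ∈ q E := hE ▸ Submodule.mem_top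
    exact this

/-- A simple extension generated by an element integral over a subfield `F` of `K` descends to
the algebraic closure of `F` in `K`. -/
theorem descends_algebraicClosure {k K L : Type u} (F : Type*) [Field k] [Field F] [Field K]
    [Field L] [Algebra k F] [Algebra k K] [Algebra F K] [IsScalarTower k F K] [Algebra K L]
    [Algebra F L] [IsScalarTower F K L] {β : L} (hβ : IsIntegral F β)
    (htop : IntermediateField.adjoin K {β} = ⊤) :
    Descends k L ((algebraicClosure F K).restrictScalars k) := by
  have hβK : IsIntegral K β := hβ.tower_top
  obtain ⟨g, hg⟩ := (Polynomial.mem_lifts _).mp <|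
    integralClosure.mem_lifts_of_monic_of_dvd_map K (minpoly.monic hβ) (minpoly.monic hβK)
      (minpoly.dvd_map_of_isScalarTower F K β)
  let M : IntermediateField k K := (algebraicClosure F K).restrictScalars k
  let g' : Polynomial M := g
  have hg' : g'.map (algebraMap M K) = minpoly K β := hg
  refine ⟨AdjoinRoot g', inferInstance, inferInstance, ⟨?_⟩⟩
  refine (AdjoinRoot.tensorAlgEquiv g' _ rfl).trans ?_
  refine (AdjoinRoot.mapAlgEquiv (Algebra.TensorProduct.rid M K K) _ (minpoly K β) ?_).trans ?_
  · rw [← hg', Polynomial.map_map]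
    refine Associated.of_eq (congrArg (Polynomial.map · g') (RingHom.ext fun x ↦ ?_))
    exact (Algebra.TensorProduct.rid_tmul (S := K) x (1 : K)).trans (mul_one (x : K))
  · exact (IntermediateField.adjoinRootEquivAdjoin K hβK).trans
      ((IntermediateField.equivOfEq htop).trans IntermediateField.topEquiv)

/-- Passing to the algebraic closure of `F` in `K` does not increase the transcendence degree. -/
theorem trdeg_algebraicClosure_le {k K : Type u} [Field k] [Field K] [Algebra k K]
    (F : Type u) [Field F] [Algebra k F] [Algebra F K] [IsScalarTower k F K] :
    trdeg k ((algebraicClosure F K).restrictScalars k) ≤ trdeg k F := by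
  change Algebra.trdeg k (algebraicClosure F K) ≤ Algebra.trdeg k F
  rw [← trdeg_add_eq k F (A := algebraicClosure F K),
    trdeg_eq_zero (R := F) (A := algebraicClosure F K), add_zero]

/-- If a finite-dimensional extension `L/K` descends to `K₀`, then `L` is generated over `K` by
a finite-dimensional `K₀`-subalgebra. -/
theorem Descends.exists_subalgebra {k K L : Type u} [Field k] [Field K] [Field L] [Algebra k K]
    [Algebra K L] [FiniteDimensional K L] {K₀ : IntermediateField k K} (h : Descends k L K₀) :
    ∃ S : Subalgebra K₀ L, FiniteDimensional K₀ S ∧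
      IntermediateField.adjoin K (S : Set L) = ⊤ := by
  obtain ⟨A₀, _, _, ⟨e⟩⟩ := h
  have : FiniteDimensional K (K ⊗[K₀] A₀) := e.symm.toLinearEquiv.finiteDimensional
  have : FiniteDimensional K₀ A₀ := by
    rw [FiniteDimensional, ← Module.rank_lt_aleph0_iff, Module.rank_baseChange,
      Cardinal.lift_id] at this
    exact Module.rank_lt_aleph0_iff.mp this
  let f : A₀ →ₐ[K₀] L := (e.toAlgHom.restrictScalars K₀).comp Algebra.TensorProduct.includeRight
  refine ⟨f.range, inferInstanceAs (FiniteDimensional K₀ f.toLinearMap.range), ?_⟩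
  refine top_le_iff.mp fun x _ ↦ ?_
  obtain ⟨y, rfl⟩ := e.surjective x
  induction y with
  | zero => simp
  | add a b ha hb => rw [map_add]; exact add_mem (ha trivial) (hb trivial)
  | tmul a b =>
    rw [show a ⊗ₜ[K₀] b = a • ((1 : K) ⊗ₜ[K₀] b) by simp [TensorProduct.smul_tmul'], map_smul]
    exact IntermediateField.smul_mem _ (IntermediateField.subset_adjoin K (f.range : Set L) ⟨b, rfl⟩)

/-- Let `k ⊆ K ⊆ L` with `L/K` simple and finite, let `K'/K` be a field
extension, and let `L' = K'L` be a compositum of `K'` and `L` over `K` (i.e. `L'` is generated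
over `K'` by the image of a `K`-embedding `ι : L → L'`). Then `ed_k(L'/K') ≤ ed_k(L/K)`. -/
theorem statement_6 (k K L K' L' : Type u) [Field k] [Field K] [Field L] [Field K'] [Field L']
    [Algebra k K] [Algebra K L] [FiniteDimensional K L]
    (hsimple : ∃ α : L, IntermediateField.adjoin K {α} = ⊤)
    [Algebra k K'] [Algebra K K'] [IsScalarTower k K K']
    [Algebra K' L'] [Algebra K L'] [IsScalarTower K K' L']
    (ι : L →ₐ[K] L')
    (hgen : IntermediateField.adjoin K' (Set.range ι) = ⊤) :
    ed k K' L' ≤ ed k K L := by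
  have : Nonempty {K₀ : IntermediateField k K // Descends k L K₀} := by
    obtain ⟨α, hα⟩ := hsimple
    exact ⟨⟨_, descends_algebraicClosure K (IsIntegral.of_finite K α) hα⟩⟩
  refine le_ciInf fun ⟨K₀, hK₀⟩ ↦ ?_
  obtain ⟨S, _, hS⟩ := hK₀.exists_subalgebra
  obtain ⟨β, hβS, hβ⟩ := exists_mem_subalgebra_adjoin_eq_top hsimple S hS
  have hint : IsIntegral K₀ β := (IsIntegral.of_finite K₀ (⟨β, hβS⟩ : S)).map S.val
  have : IsScalarTower K₀ K' L' := .of_algebraMap_eq fun x ↦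
    IsScalarTower.algebraMap_apply K K' L' (x : K)
  have htop : IntermediateField.adjoin K' {ι β} = ⊤ := by
    rw [← top_le_iff, ← hgen, IntermediateField.adjoin_le_iff]
    rintro _ ⟨x, rfl⟩
    have hle : IntermediateField.adjoin K {β} ≤
        ((IntermediateField.adjoin K' {ι β}).restrictScalars K).comap ι :=
      IntermediateField.adjoin_simple_le_iff.mpr (IntermediateField.mem_adjoin_simple_self K' (ι β))
    exact hle (hβ ▸ IntermediateField.mem_top)
  refine (ciInf_le' _ ⟨_, descends_algebraicClosure (k := k) K₀
    (hint.map (ι.restrictScalars K₀)) htop⟩).trans ?_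
  exact trdeg_algebraicClosure_le K₀
end

section
/- Let k ⊆ K ⊆ L be fields with [L:K] < ∞, where K and L are complete with respect to a discrete valuation ν: L* → ℤ (restricting to a discrete valuation on K), with residue fields K_ν and L_ν, and the valuation restricts to k with residue field k_ν. Assume that L/K is a Galois extension whose Galois group H = Gal(L/K) is a non-abelian finite simple group, and that L_ν is separable over K_ν. Then ed_{k_ν}(L_ν/K_ν) ≤ ed_k(L/K). -/
open scoped TensorProduct

universe u

noncomputable section

/-- The value monoid of a (normalized) discrete valuation: `ℤ` with a zero adjoined. -/
abbrev Zm0 : Type := WithZero (Multiplicative ℤ)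

/-- The valuation ring of the restriction to a subfield `F ⊆ L` of the valuation `v` on `L`. -/
abbrev valRing {L : Type u} [Field L] (v : Valuation L Zm0)
    (F : Type u) [Field F] [Algebra F L] : ValuationSubring F :=
  (v.comap (algebraMap F L)).valuationSubring

/-- The residue field of a subfield `F ⊆ L` with respect to (the restriction of) the
valuation `v` on `L`. -/
abbrev Res {L : Type u} [Field L] (v : Valuation L Zm0)
    (F : Type u) [Field F] [Algebra F L] : Type u :=
  IsLocalRing.ResidueField (valRing v F)

/-- The map between the valuation rings of subfields `F ⊆ F'` of `L` induced by inclusion. -/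
def valRingHom {L : Type u} [Field L] (v : Valuation L Zm0) (F F' : Type u) [Field F] [Field F']
    [Algebra F L] [Algebra F' L] [Algebra F F'] [IsScalarTower F F' L] :
    valRing v F →+* valRing v F' where
  toFun x := ⟨algebraMap F F' x, by
    rw [Valuation.mem_valuationSubring_iff, Valuation.comap_apply,
      ← IsScalarTower.algebraMap_apply F F' L]
    exact x.2⟩
  map_one' := by ext; simp
  map_mul' x y := by ext; simp
  map_zero' := by ext; simp
  map_add' x y := by ext; simp

instance isLocalHom_valRingHom {L : Type u} [Field L] (v : Valuation L Zm0) (F F' : Type u)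
    [Field F] [Field F'] [Algebra F L] [Algebra F' L] [Algebra F F'] [IsScalarTower F F' L] :
    IsLocalHom (valRingHom v F F') := by
  constructor
  intro x hx
  rw [ValuationSubring.valuation_eq_one_iff] at hx ⊢
  rw [← (Valuation.isEquiv_valuation_valuationSubring _).eq_one_iff_eq_one] at hx ⊢
  rw [Valuation.comap_apply] at hx ⊢
  have h : algebraMap F' L ((valRingHom v F F' x : F')) = algebraMap F L (x : F) := by
    show algebraMap F' L (algebraMap F F' (x : F)) = _
    rw [← IsScalarTower.algebraMap_apply F F' L]
  rwa [h] at hx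

/-- The map between the residue fields of subfields `F ⊆ F'` of the valued field `L`,
induced by the inclusion `F ⊆ F'`. -/
def resHom {L : Type u} [Field L] (v : Valuation L Zm0) (F F' : Type u) [Field F] [Field F']
    [Algebra F L] [Algebra F' L] [Algebra F F'] [IsScalarTower F F' L] :
    Res v F →+* Res v F' :=
  IsLocalRing.ResidueField.map (valRingHom v F F')

end

/-- A rank one valuation on an algebraic extension `L/K` for which `K` is complete is invariant
under the automorphisms of `L/K`. -/
theorem Valuation.apply_algEquiv_of_isComplete {K L Γ : Type*} [Field K] [Field L] [Algebra K L]
    [Algebra.IsAlgebraic K L] [LinearOrderedCommGroupWithZero Γ] [MulArchimedean Γ]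
    [Valued L Γ] (hK : IsComplete (Set.range (algebraMap K L)))
    (hv : (Valued.v : Valuation L Γ).IsNontrivial) (σ : L ≃ₐ[K] L) (x : L) :
    (Valued.v (σ x) : Γ) = Valued.v x := by
  have : MulArchimedean (MonoidWithZeroHom.ValueGroup₀ (.ofClass (Valued.v : Valuation L Γ))) :=
    MulArchimedean.comap MonoidWithZeroHom.ValueGroup₀.embedding.toMonoidHom
      MonoidWithZeroHom.ValueGroup₀.embedding_strictMono
  obtain ⟨hR⟩ := Valuation.nonempty_rankOne_iff_mulArchimedean.mpr this
  let _ : NormedField L := Valued.toNormedField L Γ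
  have : IsUltrametricDist L := Valued.instIsUltrametricDist L Γ
  let _ : NormedField K := NormedField.induced K L (algebraMap K L) (algebraMap K L).injective
  have : IsUltrametricDist K :=
    ⟨fun x y z ↦ dist_triangle_max (algebraMap K L x) (algebraMap K L y) (algebraMap K L z)⟩
  have hnt : ∃ a : K, 1 < ‖a‖ := by
    by_contra! h
    have hle (z : L) : (Valued.v z : Γ) ≤ 1 := by
      let f : K →+* (Valued.v : Valuation L Γ).integer :=
        (algebraMap K L).codRestrict _ fun a ↦ Valued.toNormedField.norm_le_one_iff.mp (h a)
      have hz : IsIntegral (Valued.v : Valuation L Γ).integer z := by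
        obtain ⟨p, hp, hpz⟩ := Algebra.IsIntegral.isIntegral (R := K) z
        exact ⟨p.map f, hp.map f, by rwa [Polynomial.eval₂_map]⟩
      exact (Valuation.integer.integers _).mem_of_integral hz
    obtain ⟨y, hy0, hy1⟩ := hv.exists_val_nontrivial
    have hy := hle y⁻¹
    rw [map_inv₀, inv_le_one₀ (zero_lt_iff.mpr hy0)] at hy
    exact hy1 (le_antisymm (hle y) hy)
  let _ : NontriviallyNormedField K := NontriviallyNormedField.ofNormNeOne (by
    obtain ⟨a, ha⟩ := hnt
    exact ⟨a, fun h ↦ by simp [h] at ha; linarith, ha.ne'⟩)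
  have : CompleteSpace K :=
    (completeSpace_iff_isComplete_range (f := algebraMap K L) ⟨rfl⟩).mpr hK
  have hspec (y : L) : ‖y‖ = spectralNorm K L y :=
    spectralNorm_unique_field_norm_ext (f := NormedField.toAbsoluteValue L) (fun _ ↦ rfl) y
  have hσ : ‖σ x‖ = ‖x‖ := by rw [hspec, hspec, ← spectralNorm_eq_of_equiv]
  exact le_antisymm (Valued.toNormedField.norm_le_iff.mp hσ.le)
    (Valued.toNormedField.norm_le_iff.mp hσ.ge)

/-- If `A` descends to `K₀`, then the relative algebraic closure of `K₀` in `L` detects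
`K`-automorphisms of `L`. -/
theorem Descends.eq_one_of_forall_algebraicClosure {k K L : Type u} [Field k] [Field K] [Field L]
    [Algebra k K] [Algebra K L] [FiniteDimensional K L] {K₀ : IntermediateField k K}
    (h : Descends k L K₀) (σ : L ≃ₐ[K] L) (hσ : ∀ x ∈ algebraicClosure K₀ L, σ x = x) :
    σ = 1 := by
  obtain ⟨A₀, _, _, ⟨e⟩⟩ := h
  have hfin : FiniteDimensional K₀ A₀ := by
    have h1 : Module.rank K (K ⊗[K₀] A₀) < Cardinal.aleph0 := by
      rw [e.toLinearEquiv.rank_eq]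
      exact Module.rank_lt_aleph0 K L
    rw [Module.rank_baseChange, Cardinal.lift_id] at h1
    exact Module.rank_lt_aleph0_iff.mp h1
  have hA (a : A₀) : σ (e (1 ⊗ₜ a)) = e (1 ⊗ₜ a) := by
    refine hσ _ (mem_algebraicClosure_iff.mpr (IsIntegral.isAlgebraic ?_))
    exact (Algebra.IsIntegral.isIntegral (R := K₀) a).map
      ((e.toAlgHom.restrictScalars K₀).comp Algebra.TensorProduct.includeRight)
  ext x
  obtain ⟨t, rfl⟩ := e.surjective x
  induction t with
  | zero => simp
  | add s t hs ht => simpa using congr($hs + $ht)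
  | tmul c a =>
    have : c ⊗ₜ[K₀] a = c • (1 ⊗ₜ[K₀] a) := by simp [TensorProduct.smul_tmul']
    simp [this, hA]

theorem trdeg_algebraicClosure {k K L : Type u} [Field k] [Field K] [Field L] [Algebra k K]
    [Algebra K L] [Algebra k L] [IsScalarTower k K L] (K₀ : IntermediateField k K) :
    trdeg k ((algebraicClosure K₀ L).restrictScalars k) = trdeg k K₀ := by
  have h := trdeg_add_eq k K₀ (A := algebraicClosure K₀ L)
  rw [trdeg_eq_zero (R := K₀), add_zero] at h
  exact h.symm

/-- A perfect group acting on a valued field by isometries, and trivially on the residue field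
of a stable subfield, acts trivially on that subfield. -/
theorem smul_eq_of_commutator_eq_top {G L : Type*} [Group G] [Field L] [MulSemiringAction G L]
    (hG : commutator G = ⊤) (v : Valuation L Zm0) (hv : ∀ (g : G) x, v (g • x) = v x)
    (M : Subfield L) (hM : ∀ (g : G), ∀ x ∈ M, g • x ∈ M)
    (hres : ∀ (g : G), ∀ x ∈ M, v x ≤ 1 → v (g • x - x) < 1) (g : G) {x : L} (hx : x ∈ M) :
    g • x = x := by
  have key (n : ℕ) : ∀ (g : G), ∀ x ∈ M, v (g • x - x) ≤ WithZero.exp (-(n : ℤ)) * v x := by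
    induction n with
    | zero =>
      intro g x hx
      simpa [hv] using v.map_sub (g • x) x
    | succ n ih =>
      let N : Subgroup G :=
        { carrier := {g | ∀ x ∈ M, v (g • x - x) ≤ WithZero.exp (-((n + 1 : ℕ) : ℤ)) * v x}
          one_mem' := fun x _ ↦ by simp
          mul_mem' := fun {a b} ha hb x hx ↦ by
            have : (a * b) • x - x = a • (b • x - x) + (a • x - x) := by
              rw [mul_smul, smul_sub]; ring
            rw [this]
            exact v.map_add_le ((hv a _).trans_le (hb x hx)) (ha x hx)
          inv_mem' := fun {a} ha x hx ↦ by
            have := ha (a⁻¹ • x) (hM _ _ hx)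
            rwa [smul_inv_smul, hv, Valuation.map_sub_swap] at this }
      suffices N = ⊤ from fun g ↦ (this ▸ Subgroup.mem_top g : g ∈ N)
      rw [← top_le_iff, ← hG, commutator_def, Subgroup.commutator_le]
      intro a _ b _ x hx
      have hcomm : ∀ y ∈ M, v (a • b • y - b • a • y) ≤
          WithZero.exp (-((n + 1 : ℕ) : ℤ)) * v y := by
        intro y hy
        rcases eq_or_ne y 0 with rfl | hy0
        · simp
        rcases n.eq_zero_or_pos with rfl | hn
        · have hvy : v y ≠ 0 := by simpa using hy0
          have hunit (c : G) : v (c • y / y) = 1 := by simp [hv, hvy]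
          have hmem (c : G) : c • y / y ∈ M := M.div_mem (hM c y hy) hy
          have hsmul (c d : G) : c • d • y = c • (d • y / y) * (c • y / y) * y := by
            rw [mul_assoc, div_mul_cancel₀ _ hy0, ← smul_mul', div_mul_cancel₀ _ hy0]
          have heq : a • b • y - b • a • y = ((a • (b • y / y) - b • y / y) * (a • y / y) -
              (b • (a • y / y) - a • y / y) * (b • y / y)) * y := by
            rw [hsmul, hsmul]; ring
          rw [heq, map_mul]
          refine mul_le_mul_left ?_ _
          rw [← WithZero.lt_mul_exp_iff_le (by simp), ← WithZero.exp_add]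
          simp only [Nat.cast_one, zero_add, neg_add_cancel, WithZero.exp_zero]
          refine (v.map_sub _ _).trans_lt (max_lt ?_ ?_) <;> rw [map_mul, hunit, mul_one]
          exacts [hres _ _ (hmem _) (hunit _).le, hres _ _ (hmem _) (hunit _).le]
        · have hstep (c d : G) : v (c • (d • y - y) - (d • y - y)) ≤
              WithZero.exp (-((n + 1 : ℕ) : ℤ)) * v y := by
            refine (ih c _ (M.sub_mem (hM d y hy) hy)).trans ?_
            refine (mul_le_mul_right (ih d y hy) _).trans ?_
            rw [← mul_assoc, ← WithZero.exp_add]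
            exact mul_le_mul_left (WithZero.exp_le_exp.mpr (by push_cast; omega)) _
          have heq : a • b • y - b • a • y =
              (a • (b • y - y) - (b • y - y)) - (b • (a • y - y) - (a • y - y)) := by
            simp only [smul_sub]; ring
          rw [heq]
          exact (v.map_sub _ _).trans (max_le (hstep a b) (hstep b a))
      have h := hcomm (a⁻¹ • b⁻¹ • x) (hM _ _ (hM _ _ hx))
      simpa [commutatorElement_def, mul_smul, hv] using h
  by_contra hne
  have hne' : v (g • x - x) ≠ 0 := by simpa [sub_eq_zero] using hne
  have hx0 : v x ≠ 0 := fun h ↦ by simp_all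
  obtain ⟨n, hn⟩ := WithZero.exists_exp_neg_natCast_lt (div_ne_zero hne' hx0)
  exact hn.not_ge ((div_le_iff₀ (zero_lt_iff.mpr hx0)).mpr (key n g x hx))

/-- Two Galois extensions `M/F₀` and `E/F` with the same group, compatible with an inclusion
`M ⊆ E`, satisfy `E = F ⊗ M`. -/
theorem nonempty_tensorProduct_algEquiv_of_isGaloisGroup {F₀ M F E H : Type*} [Field F₀] [Field M]
    [Field F] [Field E] [Algebra F₀ M] [Algebra F₀ F] [Algebra F E] [Algebra M E] [Algebra F₀ E]
    [IsScalarTower F₀ M E] [IsScalarTower F₀ F E] [Group H] [Finite H] [MulSemiringAction H M]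
    [MulSemiringAction H E] [IsGaloisGroup H F₀ M] [IsGaloisGroup H F E]
    (hsmul : ∀ (h : H) (x : M), algebraMap M E (h • x) = h • algebraMap M E x) :
    Nonempty (F ⊗[F₀] M ≃ₐ[F] E) := by
  have : FiniteDimensional F E := IsGaloisGroup.finiteDimensional H F E
  have : FiniteDimensional F₀ M := IsGaloisGroup.finiteDimensional H F₀ M
  let μ : F ⊗[F₀] M →ₐ[F] E := Algebra.TensorProduct.lift (Algebra.ofId F E)
    (IsScalarTower.toAlgHom F₀ M E) fun _ _ ↦ .all _ _
  have hμ (x : M) : μ (1 ⊗ₜ x) = algebraMap M E x := by simp [μ]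
  have hsurj : Function.Surjective μ := by
    let E' : IntermediateField F E := subalgebraEquivIntermediateField μ.range
    have hE' : fixingSubgroup H (E' : Set E) = ⊥ := by
      rw [eq_bot_iff]
      intro h hh
      have := IsGaloisGroup.faithful F₀ (G := H) (B := M)
      refine FaithfulSMul.eq_of_smul_eq_smul (α := M) fun x ↦ (algebraMap M E).injective ?_
      rw [hsmul, one_smul]
      exact (mem_fixingSubgroup_iff H).mp hh _ ⟨1 ⊗ₜ x, hμ _⟩
    have h1 := IsGaloisGroup.card_fixingSubgroup_eq_finrank H F E E'
    rw [hE', Subgroup.card_bot, eq_comm, IntermediateField.finrank_eq_one_iff_eq_top] at h1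
    intro y
    exact (h1 ▸ IntermediateField.mem_top : y ∈ E')
  have hdim : Module.finrank F (F ⊗[F₀] M) = Module.finrank F E := by
    rw [Module.finrank_baseChange, ← IsGaloisGroup.card_eq_finrank H F₀ M,
      ← IsGaloisGroup.card_eq_finrank H F E]
  have hinj : Function.Injective μ :=
    (LinearMap.injective_iff_surjective_of_finrank_eq_finrank (f := μ.toLinearMap) hdim).mpr hsurj
  exact ⟨AlgEquiv.ofBijective μ ⟨hinj, hsurj⟩⟩

/-- Let a finite group `H` act on `E` with field of invariants `F`. If `m` is an `H`-stable
subfield on which `H` acts faithfully, then `E/F` descends to the subfield `m ∩ F`. -/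
theorem descends_comap_of_faithful {κ F E H : Type u} [Field κ] [Field F] [Field E]
    [Algebra κ F] [Algebra F E] [Algebra κ E] [IsScalarTower κ F E] [Group H] [Finite H]
    [MulSemiringAction H E] [IsGaloisGroup H F E] (m : IntermediateField κ E)
    (hstable : ∀ (h : H), ∀ x ∈ m, h • x ∈ m)
    (hfaithful : ∀ h : H, (∀ x ∈ m, h • x = x) → h = 1) :
    Descends κ E (m.comap (IsScalarTower.toAlgHom κ F E)) := by
  set K₀ : IntermediateField κ F := m.comap (IsScalarTower.toAlgHom κ F E)
  let φ : K₀ →+* m := ((algebraMap F E).comp (algebraMap K₀ F)).codRestrict m fun x ↦ x.2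
  let _ : Algebra K₀ m := φ.toAlgebra
  have : IsScalarTower K₀ m E := .of_algebraMap_eq fun _ ↦ rfl
  have smul_algebraMap (h : H) (c : F) : h • algebraMap F E c = algebraMap F E c := by
    simp
  let _ : MulSemiringAction H m :=
    { smul := fun h x ↦ ⟨h • (x : E), hstable h x x.2⟩
      one_smul := fun x ↦ Subtype.ext (one_smul H (x : E))
      mul_smul := fun g h x ↦ Subtype.ext (mul_smul g h (x : E))
      smul_zero := fun h ↦ Subtype.ext (smul_zero h)
      smul_add := fun h x y ↦ Subtype.ext (smul_add h (x : E) y)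
      smul_one := fun h ↦ Subtype.ext (smul_one h)
      smul_mul := fun h x y ↦ Subtype.ext (smul_mul' h (x : E) y) }
  have coe_smul (h : H) (x : m) : ((h • x : m) : E) = h • (x : E) := rfl
  have hgal : IsGaloisGroup H K₀ m :=
    { faithful := ⟨fun {g h} hgh ↦ by
        rw [← inv_mul_eq_one]
        refine hfaithful _ fun x hx ↦ ?_
        rw [mul_smul, inv_smul_eq_iff]
        exact congr(($(hgh ⟨x, hx⟩) : E)).symm⟩
      commutes := ⟨fun h c x ↦ Subtype.ext <| by
        change h • (algebraMap F E c * (x : E)) = algebraMap F E c * h • (x : E)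
        rw [smul_mul', smul_algebraMap]⟩
      isInvariant := ⟨fun x hx ↦ by
        obtain ⟨c, hc⟩ := Algebra.IsInvariant.isInvariant (A := F) (G := H) (x : E)
          fun h ↦ congr(($(hx h) : E))
        exact ⟨⟨c, by change algebraMap F E c ∈ m; rw [hc]; exact x.2⟩, Subtype.ext hc⟩⟩ }
  exact ⟨m, inferInstance, inferInstance,
    nonempty_tensorProduct_algEquiv_of_isGaloisGroup (H := H) coe_smul⟩

theorem trdeg_comap_le {κ F E : Type u} [Field κ] [Field F] [Field E]
    [Algebra κ F] [Algebra F E] [Algebra κ E] [IsScalarTower κ F E] (m : IntermediateField κ E) :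
    trdeg κ (m.comap (IsScalarTower.toAlgHom κ F E)) ≤ trdeg κ m := by
  let φ : m.comap (IsScalarTower.toAlgHom κ F E) →ₐ[κ] m :=
    ((IsScalarTower.toAlgHom κ F E).comp (IntermediateField.val _)).codRestrict m.toSubalgebra
      fun x ↦ x.2
  exact ciSup_le' fun s ↦ (s.2.map' φ.toRingHom.injective).cardinalMk_le_trdeg

/-- An invariant of a finite group acting on a local ring lifts residually to the ring of
invariants, if the residue field extension is separable. -/
theorem IsLocalRing.ResidueField.isInvariant_of_isSeparable {A B G : Type*} [CommRing A]
    [CommRing B] [IsLocalRing A] [IsLocalRing B] [Algebra A B] [Group G] [Finite G]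
    [MulSemiringAction G B] [Algebra.IsInvariant A B G] [Algebra (ResidueField A) (ResidueField B)]
    [Algebra.IsSeparable (ResidueField A) (ResidueField B)]
    (hAB : (algebraMap (ResidueField A) (ResidueField B)).comp (residue A) =
      (residue B).comp (algebraMap A B)) :
    Algebra.IsInvariant (ResidueField A) (ResidueField B) G := by
  refine ⟨fun y hy ↦ ?_⟩
  have := Fintype.ofFinite G
  obtain ⟨b, rfl⟩ := residue_surjective y
  obtain ⟨p, hp⟩ := Algebra.IsInvariant.charpoly_mem_lifts A B G b
  have hmap : (p.map (residue A)).map (algebraMap (ResidueField A) (ResidueField B)) =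
      (Polynomial.X - Polynomial.C (residue B b)) ^ Fintype.card G := by
    have : ((MulSemiringAction.charpoly G b).map (residue B)) =
      (Polynomial.X - Polynomial.C (residue B b)) ^ Fintype.card G := by
      simp [MulSemiringAction.charpoly, Polynomial.map_prod, residue_smul, hy]
    rw [← this, ← hp, Polynomial.coe_mapRingHom, Polynomial.map_map, Polynomial.map_map, hAB]
  have hdvd : (minpoly (ResidueField A) (residue B b)).map (algebraMap _ (ResidueField B)) ∣
      Polynomial.X - Polynomial.C (residue B b) := by
    rw [← Squarefree.dvd_pow_iff_dvd (n := Fintype.card G) _ Fintype.card_ne_zero, ← hmap]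
    · refine Polynomial.map_dvd _ (minpoly.dvd _ _ ?_)
      rw [← Polynomial.eval_map_algebraMap, hmap]
      simp [Fintype.card_ne_zero]
    · exact (Polynomial.Separable.map
        (Algebra.IsSeparable.isSeparable (ResidueField A) (residue B b))).squarefree
  have hdeg := Polynomial.natDegree_le_of_dvd hdvd (Polynomial.X_sub_C_ne_zero _)
  rw [Polynomial.natDegree_map, Polynomial.natDegree_X_sub_C] at hdeg
  have hint := Algebra.IsIntegral.isIntegral (R := ResidueField A) (residue B b)
  exact minpoly.natDegree_eq_one_iff.mp (hdeg.antisymm (minpoly.natDegree_pos hint))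

theorem resHom_resHom {L : Type u} [Field L] (v : Valuation L Zm0) (F F' F'' : Type u) [Field F]
    [Field F'] [Field F''] [Algebra F L] [Algebra F' L] [Algebra F'' L] [Algebra F F']
    [Algebra F' F''] [Algebra F F''] [IsScalarTower F F' L] [IsScalarTower F' F'' L]
    [IsScalarTower F F'' L] [IsScalarTower F F' F''] (x : Res v F) :
    resHom v F' F'' (resHom v F F' x) = resHom v F F'' x := by
  obtain ⟨a, rfl⟩ := IsLocalRing.residue_surjective x
  simp only [resHom, IsLocalRing.ResidueField.map_residue]
  congr 1
  exact Subtype.ext (IsScalarTower.algebraMap_apply F F' F'' _).symm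

theorem residue_eq_residue_iff {L : Type u} [Field L] (v : Valuation L Zm0) (F : Type u) [Field F]
    [Algebra F L] (a b : valRing v F) :
    IsLocalRing.residue (valRing v F) a = IsLocalRing.residue (valRing v F) b ↔
      v (algebraMap F L (a - b)) < 1 := by
  rw [← sub_eq_zero, ← map_sub, IsLocalRing.residue_eq_zero_iff]
  exact (ValuationSubring.valuation_lt_one_iff _ (a - b)).trans
    (Valuation.isEquiv_valuation_valuationSubring _).lt_one_iff_lt_one.symm

/-- Lifts of elements of the residue field that are algebraically independent over the residue
field of `k` are algebraically independent over `k`. -/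
theorem algebraicIndependent_of_residue {k L ι : Type u} [Field k] [Field L] [Algebra k L]
    (v : Valuation L Zm0) (x : ι → valRing v L)
    (hx : letI := (resHom v k L).toAlgebra
      AlgebraicIndependent (Res v k) fun i ↦ IsLocalRing.residue _ (x i)) :
    AlgebraicIndependent k fun i ↦ (x i : L) := by
  let _ := (resHom v k L).toAlgebra
  rw [algebraicIndependent_iff]
  intro p hp
  by_contra hp0
  obtain ⟨d, hd, hmax⟩ := p.support.exists_max_image
    (fun d ↦ v (algebraMap k L (p.coeff d))) (MvPolynomial.support_nonempty.mpr hp0)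
  set c := p.coeff d with hc
  have hc0 : c ≠ 0 := MvPolynomial.mem_support_iff.mp hd
  have hvc : 0 < v (algebraMap k L c) := by simpa [zero_lt_iff] using hc0
  obtain ⟨q, hq⟩ : ∃ q : MvPolynomial ι (valRing v k),
      q.map (valRing v k).subtype = MvPolynomial.C c⁻¹ * p := by
    rw [← Set.mem_range, MvPolynomial.mem_range_map_iff_coeffs_subset]
    intro a ha
    obtain ⟨e, -, rfl⟩ := MvPolynomial.mem_coeffs_iff.mp ha
    rw [MvPolynomial.coeff_C_mul]
    refine ⟨⟨c⁻¹ * p.coeff e, ?_⟩, rfl⟩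
    rw [Valuation.mem_valuationSubring_iff, Valuation.comap_apply, map_mul, map_mul, map_inv₀,
      map_inv₀, inv_mul_le_iff₀ hvc, mul_one]
    by_cases he : e ∈ p.support
    · exact hmax e he
    · simp [MvPolynomial.notMem_support_iff.mp he]
  have hqd : q.coeff d = 1 := by
    apply Subtype.ext
    have := congr(MvPolynomial.coeff d $hq)
    rw [MvPolynomial.coeff_map, MvPolynomial.coeff_C_mul, ← hc, inv_mul_cancel₀ hc0] at this
    exact this
  have hqx : MvPolynomial.eval₂ (valRingHom v k L) x q = 0 := by
    apply Subtype.ext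
    have h : MvPolynomial.aeval (fun i ↦ (x i : L)) (q.map (valRing v k).subtype) = 0 := by
      rw [hq, map_mul, hp, mul_zero]
    rw [MvPolynomial.aeval_def, MvPolynomial.eval₂_map] at h
    exact (MvPolynomial.eval₂_comp_left (valRing v L).subtype (valRingHom v k L) x q).trans h
  have hzero : q.map (IsLocalRing.residue (valRing v k)) = 0 := by
    refine algebraicIndependent_iff.mp hx _ ?_
    rw [MvPolynomial.aeval_def, MvPolynomial.eval₂_map]
    exact (MvPolynomial.eval₂_comp_left (IsLocalRing.residue _) (valRingHom v k L) x q).symm.trans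
      (by rw [hqx, map_zero])
  have := congr(MvPolynomial.coeff d $hzero)
  rw [MvPolynomial.coeff_map, hqd, map_one, MvPolynomial.coeff_zero] at this
  exact one_ne_zero this

/-- The residue field of an intermediate field `M` of `L/k`, inside the residue field of `L`. -/
noncomputable def residueSubfield {k L : Type u} [Field k] [Field L] [Algebra k L]
    (v : Valuation L Zm0) (M : IntermediateField k L) :
    letI := (resHom v k L).toAlgebra
    IntermediateField (Res v k) (Res v L) :=
  letI := (resHom v k L).toAlgebra
  (resHom v M L).fieldRange.toIntermediateField fun x ↦ ⟨resHom v k M x, resHom_resHom v k M L x⟩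

theorem mem_residueSubfield {k L : Type u} [Field k] [Field L] [Algebra k L]
    {v : Valuation L Zm0} {M : IntermediateField k L} {y : Res v L} :
    letI := (resHom v k L).toAlgebra
    y ∈ residueSubfield v M ↔
      ∃ a : valRing v L, (a : L) ∈ M ∧ IsLocalRing.residue (valRing v L) a = y := by
  constructor
  · rintro ⟨z, rfl⟩
    obtain ⟨a, rfl⟩ := IsLocalRing.residue_surjective z
    exact ⟨valRingHom v M L a, a.1.2, rfl⟩
  · rintro ⟨a, ha, rfl⟩
    exact ⟨IsLocalRing.residue _ ⟨⟨a, ha⟩, a.2⟩, rfl⟩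

theorem trdeg_residueSubfield_le {k L : Type u} [Field k] [Field L] [Algebra k L]
    (v : Valuation L Zm0) (M : IntermediateField k L) :
    letI := (resHom v k L).toAlgebra
    trdeg (Res v k) (residueSubfield v M) ≤ trdeg k M := by
  let _ := (resHom v k L).toAlgebra
  refine ciSup_le' fun s ↦ ?_
  choose x hxM hx using fun i : s.1 ↦ mem_residueSubfield.mp i.1.2
  have hind : AlgebraicIndependent k fun i ↦ (x i : L) := by
    refine algebraicIndependent_of_residue v x ?_
    simp only [hx]
    exact s.2.map' (f := (residueSubfield v M).val) (residueSubfield v M).val.injective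
  have hindM : AlgebraicIndependent k fun i ↦ (⟨x i, hxM i⟩ : M) :=
    AlgebraicIndependent.of_comp M.val hind
  exact hindM.cardinalMk_le_trdeg

/-- The action on the valuation ring of a group acting by isometries. -/
abbrev valRingAction {G L : Type u} [Group G] [Field L] [MulSemiringAction G L]
    (v : Valuation L Zm0) (hv : ∀ (g : G) x, v (g • x) = v x) :
    MulSemiringAction G (valRing v L) where
  smul g x := ⟨g • (x : L), (hv g x).trans_le x.2⟩
  one_smul x := Subtype.ext (one_smul G (x : L))
  mul_smul g h x := Subtype.ext (mul_smul g h (x : L))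
  smul_zero g := Subtype.ext (smul_zero g)
  smul_add g x y := Subtype.ext (smul_add g (x : L) y)
  smul_one g := Subtype.ext (smul_one g)
  smul_mul g x y := Subtype.ext (smul_mul' g (x : L) y)

theorem IsSimpleGroup.commutator_eq_top {G : Type*} [Group G] [IsSimpleGroup G]
    (hG : ¬ ∀ a b : G, a * b = b * a) : commutator G = ⊤ := by
  refine (IsSimpleGroup.eq_bot_or_eq_top_of_normal (commutator G) inferInstance).resolve_left ?_
  intro h
  refine hG fun a b ↦ ?_
  have := Subgroup.commutator_mem_commutator (Subgroup.mem_top a) (Subgroup.mem_top b)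
  rwa [← commutator_def, h, Subgroup.mem_bot, commutatorElement_eq_one_iff_mul_comm] at this

/-- The residue field extension of a Galois extension with an invariant valuation is Galois with
the same group, if it is separable and the group acts faithfully on it. -/
theorem isGaloisGroup_residueField {G K L : Type u} [Group G] [Finite G] [Field K] [Field L]
    [Algebra K L] [MulSemiringAction G L] [IsGaloisGroup G K L]
    (v : Valuation L Zm0) (hv : ∀ (g : G) x, v (g • x) = v x)
    (hsep : letI := (resHom v K L).toAlgebra
      Algebra.IsSeparable (Res v K) (Res v L))
    (hfaithful : letI := valRingAction v hv
      ∀ g : G, (∀ y : Res v L, g • y = y) → g = 1) :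
    letI := (resHom v K L).toAlgebra
    letI := valRingAction v hv
    IsGaloisGroup G (Res v K) (Res v L) := by
  let _ : Algebra (Res v K) (Res v L) := (resHom v K L).toAlgebra
  let _ : MulSemiringAction G (valRing v L) := valRingAction v hv
  let _ : Algebra (valRing v K) (valRing v L) := (valRingHom v K L).toAlgebra
  have : Algebra.IsInvariant (valRing v K) (valRing v L) G := by
    refine ⟨fun b hb ↦ ?_⟩
    obtain ⟨a, ha⟩ := Algebra.IsInvariant.isInvariant (A := K) (G := G) (b : L)
      fun g ↦ congr(($(hb g) : L))
    refine ⟨⟨a, ?_⟩, Subtype.ext ha⟩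
    rw [Valuation.mem_valuationSubring_iff, Valuation.comap_apply, ha]
    exact b.2
  have hcomm (g : G) (a : valRing v K) (b : valRing v L) :
      g • (valRingHom v K L a * b) = valRingHom v K L a * g • b := by
    apply Subtype.ext
    change g • (algebraMap K L a * (b : L)) = algebraMap K L a * g • (b : L)
    rw [smul_mul', smul_algebraMap]
  exact
    { faithful := ⟨fun {g h} hgh ↦ by
        rw [← inv_mul_eq_one]
        refine hfaithful _ fun y ↦ ?_
        rw [mul_smul, inv_smul_eq_iff, hgh]⟩
      commutes := ⟨fun g c y ↦ by
        obtain ⟨a, rfl⟩ := IsLocalRing.residue_surjective c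
        obtain ⟨b, rfl⟩ := IsLocalRing.residue_surjective y
        exact congrArg (IsLocalRing.residue (valRing v L)) (hcomm g a b)⟩
      isInvariant := IsLocalRing.ResidueField.isInvariant_of_isSeparable rfl }

theorem smul_mem_residueSubfield {G k L : Type u} [Group G] [Field k] [Field L] [Algebra k L]
    [MulSemiringAction G L] (v : Valuation L Zm0) (hv : ∀ (g : G) x, v (g • x) = v x)
    (M : IntermediateField k L) (hM : ∀ (g : G), ∀ x ∈ M, g • x ∈ M) (g : G) (y : Res v L)
    (hy : letI := (resHom v k L).toAlgebra
      y ∈ residueSubfield v M) :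
    letI := (resHom v k L).toAlgebra
    letI := valRingAction v hv
    g • y ∈ residueSubfield v M := by
  let _ : MulSemiringAction G (valRing v L) := valRingAction v hv
  obtain ⟨a, ha, rfl⟩ := mem_residueSubfield.mp hy
  exact mem_residueSubfield.mpr ⟨g • a, hM g a ha, rfl⟩

/-- A non-abelian finite simple group acting faithfully on a stable subfield `M` by isometries
acts faithfully on the residue field of `M`. -/
theorem eq_one_of_forall_residueSubfield {G k L : Type u} [Group G] [IsSimpleGroup G] [Field k]
    [Field L] [Algebra k L] [MulSemiringAction G L] (hG : ¬ ∀ a b : G, a * b = b * a)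
    (v : Valuation L Zm0) (hv : ∀ (g : G) x, v (g • x) = v x) (M : IntermediateField k L)
    (hM : ∀ (g : G), ∀ x ∈ M, g • x ∈ M) (hMfaithful : ∀ g : G, (∀ x ∈ M, g • x = x) → g = 1)
    (g : G) (hg : letI := valRingAction v hv
      ∀ y ∈ residueSubfield v M, g • y = y) : g = 1 := by
  let _ : MulSemiringAction G (valRing v L) := valRingAction v hv
  let N : Subgroup G := fixingSubgroup G {y : Res v L | y ∈ residueSubfield v M}
  have hN : N.Normal := ⟨fun a ha b ↦ (mem_fixingSubgroup_iff _).mpr fun y hy ↦ by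
    rw [mul_smul, mul_smul, (mem_fixingSubgroup_iff _).mp ha _
      (smul_mem_residueSubfield v hv M hM b⁻¹ y hy), smul_inv_smul]⟩
  suffices N = ⊥ by
    rw [← Subgroup.mem_bot, ← this]
    exact (mem_fixingSubgroup_iff _).mpr hg
  refine (IsSimpleGroup.eq_bot_or_eq_top_of_normal N hN).resolve_right fun htop ↦ ?_
  obtain ⟨a, ha⟩ := exists_ne (1 : G)
  refine ha (hMfaithful a fun x hx ↦ ?_)
  refine smul_eq_of_commutator_eq_top (IsSimpleGroup.commutator_eq_top hG) v hv
    M.toSubfield hM (fun b x hx hvx ↦ ?_) a hx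
  let x' : valRing v L := ⟨x, hvx⟩
  have hb : b ∈ N := htop ▸ Subgroup.mem_top b
  exact (residue_eq_residue_iff v L (b • x') x').mp
    ((mem_fixingSubgroup_iff _).mp hb _ (mem_residueSubfield.mpr ⟨x', hx, rfl⟩))

/-- Let `L/K` be Galois with group `G` a non-abelian finite simple group. Every `G`-stable
subfield `M` on which `G` acts faithfully bounds the essential dimension of the residue
extension. -/
theorem ed_residueField_le_trdeg {G k K L : Type u} [Group G] [Finite G] [IsSimpleGroup G]
    [Field k] [Field K] [Field L] [Algebra k K] [Algebra K L] [Algebra k L] [IsScalarTower k K L]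
    [MulSemiringAction G L] [IsGaloisGroup G K L] (hG : ¬ ∀ a b : G, a * b = b * a)
    (v : Valuation L Zm0) (hv : ∀ (g : G) x, v (g • x) = v x)
    (hsep : letI := (resHom v K L).toAlgebra
      Algebra.IsSeparable (Res v K) (Res v L)) (M : IntermediateField k L)
    (hM : ∀ (g : G), ∀ x ∈ M, g • x ∈ M) (hMfaithful : ∀ g : G, (∀ x ∈ M, g • x = x) → g = 1) :
    letI := (resHom v k K).toAlgebra
    letI := (resHom v K L).toAlgebra
    ed (Res v k) (Res v K) (Res v L) ≤ trdeg k M := by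
  let _ : Algebra (Res v k) (Res v K) := (resHom v k K).toAlgebra
  let _ : Algebra (Res v K) (Res v L) := (resHom v K L).toAlgebra
  let _ : Algebra (Res v k) (Res v L) := (resHom v k L).toAlgebra
  have : IsScalarTower (Res v k) (Res v K) (Res v L) :=
    .of_algebraMap_eq fun x ↦ (resHom_resHom v k K L x).symm
  let _ : MulSemiringAction G (valRing v L) := valRingAction v hv
  have hm := smul_mem_residueSubfield v hv M hM
  have hfaithful := eq_one_of_forall_residueSubfield hG v hv M hM hMfaithful
  have : IsGaloisGroup G (Res v K) (Res v L) :=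
    isGaloisGroup_residueField v hv hsep fun g hg ↦ hfaithful g fun y _ ↦ hg y
  have hdesc := descends_comap_of_faithful (F := Res v K) (residueSubfield v M) hm hfaithful
  refine (ciInf_le' (fun K₀ : {K₀ : IntermediateField (Res v k) (Res v K) //
    Descends (Res v k) (Res v L) K₀} ↦ trdeg (Res v k) K₀.1) ⟨_, hdesc⟩).trans ?_
  exact (trdeg_comap_le _).trans (trdeg_residueSubfield_le v M)

/-- Let `k ⊆ K ⊆ L` with `[L:K] < ∞`, where `L` carries a discrete valuation
`ν` (with value group `ℤ`) for which `L` and `K` are complete. Assume `L/K` is Galois with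
`Gal(L/K)` a non-abelian finite simple group, and that the residue field extension
`L_ν/K_ν` is separable. Then `ed_{k_ν}(L_ν/K_ν) ≤ ed_k(L/K)`. -/
theorem statement_15 (k K L : Type u) [Field k] [Field K] [Field L]
    [Algebra k K] [Algebra K L] [Algebra k L] [IsScalarTower k K L]
    [FiniteDimensional K L] [vL : Valued L Zm0] [CompleteSpace L]
    (hKcomplete : IsComplete (Set.range (algebraMap K L)))
    (hdiscrete : ∀ γ : Zm0, γ ≠ 0 → ∃ x : L, Valued.v x = γ)
    [IsGalois K L] (hsimple : IsSimpleGroup (L ≃ₐ[K] L))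
    (hnonabelian : ¬ ∀ a b : L ≃ₐ[K] L, a * b = b * a)
    (hres_sep : @Algebra.IsSeparable (Res (Valued.v : Valuation L Zm0) K)
      (Res (Valued.v : Valuation L Zm0) L) _ _
      ((resHom (Valued.v : Valuation L Zm0) K L).toAlgebra)) :
    @ed (Res (Valued.v : Valuation L Zm0) k) (Res (Valued.v : Valuation L Zm0) K)
      (Res (Valued.v : Valuation L Zm0) L) _ _
      ((resHom (Valued.v : Valuation L Zm0) k K).toAlgebra) _
      ((resHom (Valued.v : Valuation L Zm0) K L).toAlgebra) ≤ ed k K L := by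
  have hinv (σ : L ≃ₐ[K] L) (x : L) : (Valued.v : Valuation L Zm0) (σ • x) = Valued.v x := by
    refine Valuation.apply_algEquiv_of_isComplete hKcomplete ⟨?_⟩ σ x
    obtain ⟨x, hx⟩ := hdiscrete (WithZero.exp 1) WithZero.exp_ne_zero
    exact ⟨x, hx.trans_ne (by simp), hx.trans_ne (by simp)⟩
  have : Nonempty {K₀ : IntermediateField k K // Descends k L K₀} :=
    ⟨⟨_, descends_comap_of_faithful (H := L ≃ₐ[K] L) (⊤ : IntermediateField k L)
      (fun _ _ _ ↦ IntermediateField.mem_top)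
      fun σ hσ ↦ AlgEquiv.ext fun x ↦ hσ x IntermediateField.mem_top⟩⟩
  refine le_ciInf fun ⟨K₀, hK₀⟩ ↦ ?_
  rw [← trdeg_algebraicClosure (L := L) K₀]
  refine ed_residueField_le_trdeg hnonabelian Valued.v hinv hres_sep _ (fun σ x hx ↦ ?_)
    hK₀.eq_one_of_forall_algebraicClosure
  have hx' : IsAlgebraic K₀ x := mem_algebraicClosure_iff.mp hx
  exact mem_algebraicClosure_iff.mpr (hx'.algHom (σ.toAlgHom.restrictScalars K₀))
end
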